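/- Let p be a prime, m ≥ 1 an integer, and a : ℕ → ℂ with a(1) = 1, absolutely convergent Dirichlet series F(s) = Σ a(n) n^{-s} for Re(s) > 1, and a(p^ℓ k) = a(p^ℓ) a(k) for p ∤ k. Define the twisted series F^χ(s) = Σ a(n) χ(n) n^{-s} and the linear twist F(s, α) = Σ a(n) e^{-2πi nα} n^{-s}. Then for Re(s) > 1: F(s, 1/p^m) = Σ_{ℓ=0}^{m-1} a(p^ℓ) p^{-ℓs} Σ_{χ mod p^{m-ℓ}, χ ≠ χ₀} c(χ, p^{m-ℓ}) F^{χ^*}(s) + (1 − W_{m,p}(p^{-s}) F_p(s)^{-1}) F(s), where F_p(s) = Σ_{k≥0} a(p^k) p^{-ks}, W_{m,p}(X) = Σ_{ℓ=0}^{m-2} a(p^ℓ) X^ℓ + (p/(p-1)) a(p^{m-1}) X^{m-1}, the c(χ, p^r) are the Fourier coefficients of n ↦ e^{-2πi n/p^r} on (ℤ/p^rℤ)^*, and χ^* is the primitive character inducing χ. -/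

import Mathlib

open Complex

/-- The Dirichlet series `F(s) = ∑_{n≥1} a(n) n^{-s}`. -/
noncomputable def dirSeries (a : ℕ → ℂ) (s : ℂ) : ℂ :=
  ∑' n : ℕ, a (n + 1) * ((n + 1 : ℕ) : ℂ) ^ (-s)

/-- The local factor `F_p(s) = ∑_{k≥0} a(p^k) p^{-ks}`. -/
noncomputable def localFactor (a : ℕ → ℂ) (p : ℕ) (s : ℂ) : ℂ :=
  ∑' k : ℕ, a (p ^ k) * ((p ^ k : ℕ) : ℂ) ^ (-s)

/-- The linear twist `F(s,α) = ∑_{n≥1} a(n) e(-nα) n^{-s}`. -/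
noncomputable def linearTwist (a : ℕ → ℂ) (α : ℝ) (s : ℂ) : ℂ :=
  ∑' n : ℕ, a (n + 1) *
    Complex.exp (-(2 * Real.pi * Complex.I * ((n + 1 : ℕ) : ℂ)) * (α : ℂ)) *
    ((n + 1 : ℕ) : ℂ) ^ (-s)

/-- The twist `F^χ(s) = ∑_{n≥1} a(n) χ(n) n^{-s}` by a Dirichlet character. -/
noncomputable def charTwist {N : ℕ} (a : ℕ → ℂ) (χ : DirichletCharacter ℂ N) (s : ℂ) : ℂ :=
  ∑' n : ℕ, a (n + 1) * χ ((n + 1 : ℕ) : ZMod N) * ((n + 1 : ℕ) : ℂ) ^ (-s)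

/-- The polynomial `W_{m,p}(X) = ∑_{ℓ=0}^{m-2} a(p^ℓ) X^ℓ + (p/(p-1)) a(p^{m-1}) X^{m-1}`. -/
noncomputable def Wpoly (a : ℕ → ℂ) (p m : ℕ) (X : ℂ) : ℂ :=
  (∑ ℓ ∈ Finset.range (m - 1), a (p ^ ℓ) * X ^ ℓ) +
    ((p : ℂ) / ((p : ℂ) - 1)) * a (p ^ (m - 1)) * X ^ (m - 1)

open Finset in
theorem IsPrimitiveRoot.sum_pow_filter_not_dvd {R : Type*} [CommRing R] [IsDomain R] {p k : ℕ}
    (hp : p.Prime) {ζ : R} (hζ : IsPrimitiveRoot ζ (p ^ (k + 1))) :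
    ∑ n ∈ range (p ^ (k + 1)) with ¬ p ∣ n, ζ ^ n = if k = 0 then -1 else 0 := by
  have hmul : ∑ n ∈ range (p ^ (k + 1)) with p ∣ n, ζ ^ n = ∑ j ∈ range (p ^ k), (ζ ^ p) ^ j := by
    symm
    refine sum_nbij' (fun j => p * j) (fun n => n / p) ?_ ?_ ?_ ?_ ?_
    · intro j hj
      simp only [mem_filter, mem_range] at hj ⊢
      exact ⟨by rw [pow_succ']; exact Nat.mul_lt_mul_of_pos_left hj hp.pos, dvd_mul_right _ _⟩
    · intro n hn
      simp only [mem_filter, mem_range] at hn ⊢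
      exact Nat.div_lt_of_lt_mul (by rw [← pow_succ']; exact hn.1)
    · intro j _
      exact Nat.mul_div_cancel_left _ hp.pos
    · intro n hn
      exact Nat.mul_div_cancel' (mem_filter.1 hn).2
    · intro j _
      exact (pow_mul _ _ _).symm
  have htot := sum_filter_add_sum_filter_not (range (p ^ (k + 1))) (p ∣ ·) (ζ ^ ·)
  rw [hζ.geom_sum_eq_zero (Nat.one_lt_pow k.succ_ne_zero hp.one_lt), hmul] at htot
  split_ifs with hk
  · subst hk
    simp only [pow_zero, range_one, sum_singleton] at htot
    exact eq_neg_of_add_eq_zero_right htot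
  · have hζp : IsPrimitiveRoot (ζ ^ p) (p ^ k) :=
      hζ.pow (pow_pos hp.pos _) (pow_succ' p k)
    rwa [hζp.geom_sum_eq_zero (Nat.one_lt_pow hk hp.one_lt), zero_add] at htot

theorem DirichletCharacter.sum_range {R : Type*} [CommRing R] [IsDomain R] {N : ℕ} [NeZero N]
    (χ : DirichletCharacter R N) [Decidable (χ = 1)] :
    ∑ n ∈ Finset.range N, χ (n : ZMod N) = if χ = 1 then (N.totient : R) else 0 := by
  have h : ∑ n ∈ Finset.range N, χ (n : ZMod N) = ∑ x : ZMod N, χ x := by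
    refine Finset.sum_nbij' (fun n => (n : ZMod N)) ZMod.val ?_ ?_ ?_ ?_ ?_
    · simp
    · intro x _
      simpa using ZMod.val_lt x
    · intro n hn
      exact ZMod.val_cast_of_lt (Finset.mem_range.1 hn)
    · intro x _
      exact ZMod.natCast_zmod_val x
    · intro n _
      rfl
  rw [h]
  split_ifs with hχ
  · rw [hχ, MulChar.sum_one_eq_card_units, ZMod.card_units_eq_totient]
  · exact MulChar.sum_eq_zero_of_ne_one hχ

theorem DirichletCharacter.natCast_eq_zero_of_dvd {R : Type*} [CommMonoidWithZero R] {N p n : ℕ}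
    (hp : p.Prime) (χ : DirichletCharacter R N) (hN : p ∣ N) (hn : p ∣ n) :
    χ (n : ZMod N) = 0 := by
  refine χ.map_nonunit fun h => ?_
  exact Nat.not_coprime_of_dvd_of_dvd hp.one_lt hn hN ((ZMod.isUnit_iff_coprime n N).1 h)

/-- The trivial Fourier coefficient of `n ↦ e(-n/p^(k+1))` on `(ℤ/p^(k+1)ℤ)ˣ`. -/
theorem trivial_fourier_coefficient {p k : ℕ} (hp : p.Prime)
    (c : DirichletCharacter ℂ (p ^ (k + 1)) → ℂ)
    (hc : ∀ n : ℕ, Nat.Coprime n p →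
      Complex.exp (-(2 * Real.pi * Complex.I * n) / ((p ^ (k + 1) : ℕ) : ℂ)) =
        ∑ χ : DirichletCharacter ℂ (p ^ (k + 1)), c χ * χ (n : ZMod (p ^ (k + 1)))) :
    c 1 = if k = 0 then -1 / ((p : ℂ) - 1) else 0 := by
  classical
  have hN : p ^ (k + 1) ≠ 0 := pow_ne_zero _ hp.ne_zero
  have : NeZero (p ^ (k + 1)) := ⟨hN⟩
  have hζ := (Complex.isPrimitiveRoot_exp (p ^ (k + 1)) hN).inv
  have hp1 : (p : ℂ) - 1 ≠ 0 := sub_ne_zero.2 (by exact_mod_cast hp.one_lt.ne')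
  have h1 : ∑ n ∈ Finset.range (p ^ (k + 1)) with ¬ p ∣ n,
        (Complex.exp (2 * Real.pi * Complex.I / ((p ^ (k + 1) : ℕ) : ℂ)))⁻¹ ^ n =
      c 1 * ((p ^ (k + 1)).totient : ℂ) := by
    calc
      _ = ∑ n ∈ Finset.range (p ^ (k + 1)) with ¬ p ∣ n,
            ∑ χ : DirichletCharacter ℂ (p ^ (k + 1)), c χ * χ (n : ZMod (p ^ (k + 1))) := by
        refine Finset.sum_congr rfl fun n hn => ?_
        rw [← hc n (((Nat.Prime.coprime_iff_not_dvd hp).2 (Finset.mem_filter.1 hn).2).symm),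
          ← Complex.exp_neg, ← Complex.exp_nat_mul]
        congr 1
        ring
      _ = ∑ n ∈ Finset.range (p ^ (k + 1)),
            ∑ χ : DirichletCharacter ℂ (p ^ (k + 1)), c χ * χ (n : ZMod (p ^ (k + 1))) := by
        refine Finset.sum_subset (Finset.filter_subset _ _) fun n hn hn' => ?_
        have hpn : p ∣ n := by
          by_contra h
          exact hn' (Finset.mem_filter.2 ⟨hn, h⟩)
        refine Finset.sum_eq_zero fun χ _ => ?_
        rw [χ.natCast_eq_zero_of_dvd hp (dvd_pow_self p k.succ_ne_zero) hpn, mul_zero]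
      _ = _ := by
        rw [Finset.sum_comm]
        simp_rw [← Finset.mul_sum, DirichletCharacter.sum_range]
        simp
  rw [hζ.sum_pow_filter_not_dvd hp, Nat.totient_prime_pow_succ hp, Nat.cast_mul,
    Nat.cast_sub hp.one_le, Nat.cast_one, Nat.cast_pow] at h1
  split_ifs at h1 ⊢ with hk
  · subst hk
    rw [pow_zero, one_mul] at h1
    rw [h1, mul_div_cancel_right₀ _ hp1]
  · have hp0 : (p : ℂ) ≠ 0 := by exact_mod_cast hp.ne_zero
    simpa [hp0, hp1] using h1.symm

theorem primitiveCharacter_natCast {p r n : ℕ} (hp : p.Prime)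
    {χ : DirichletCharacter ℂ (p ^ r)} (hn : ¬ p ∣ n) :
    χ.primitiveCharacter (n : ZMod χ.conductor) = χ (n : ZMod (p ^ r)) := by
  have hcop : Nat.Coprime n (p ^ r) :=
    Nat.Coprime.pow_right _ ((Nat.Prime.coprime_iff_not_dvd hp).2 hn).symm
  exact_mod_cast χ.primitiveCharacter_apply_of_isCoprime (Nat.isCoprime_iff_coprime.2 hcop)

theorem dvd_conductor_of_ne_one {p r : ℕ} (hp : p.Prime)
    {χ : DirichletCharacter ℂ (p ^ r)} (hχ : χ ≠ 1) : p ∣ χ.conductor := by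
  have : NeZero (p ^ r) := ⟨pow_ne_zero _ hp.ne_zero⟩
  obtain ⟨j, -, hj⟩ := (Nat.dvd_prime_pow hp).1 χ.conductor_dvd_level
  rw [hj]
  refine dvd_pow_self p fun h0 => hχ ?_
  rw [DirichletCharacter.eq_one_iff_conductor_eq_one, hj, h0, pow_zero]

/-- Every positive integer is uniquely `p ^ ℓ * k` with `p ∤ k`. -/
noncomputable def powMulNotDvdEquiv {p : ℕ} (hp : p.Prime) : ℕ × {k : ℕ // ¬ p ∣ k} ≃ ℕ :=
  Equiv.ofBijective (fun x => p ^ x.1 * x.2 - 1) <| by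
    have hpos (x : ℕ × {k : ℕ // ¬ p ∣ k}) : 0 < p ^ x.1 * (x.2 : ℕ) :=
      Nat.mul_pos (pow_pos hp.pos _)
        (Nat.pos_of_ne_zero fun h => x.2.2 (by rw [h]; exact dvd_zero p))
    constructor
    · intro x y hxy
      have h : p ^ x.1 * (x.2 : ℕ) = p ^ y.1 * (y.2 : ℕ) := by
        have hx := hpos x
        have hy := hpos y
        dsimp only at hxy
        omega
      have hval (z : ℕ × {k : ℕ // ¬ p ∣ k}) : (p ^ z.1 * (z.2 : ℕ)).factorization p = z.1 := by
        have hz : (z.2 : ℕ) ≠ 0 := fun h => z.2.2 (by rw [h]; exact dvd_zero p)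
        rw [Nat.factorization_mul (pow_ne_zero _ hp.ne_zero) hz]
        simp [hp.factorization_self, Nat.factorization_eq_zero_of_not_dvd z.2.2]
      have h1 : x.1 = y.1 := by rw [← hval x, ← hval y, h]
      rw [h1] at h
      exact Prod.ext h1 (Subtype.ext (Nat.eq_of_mul_eq_mul_left (pow_pos hp.pos _) h))
    · intro n
      obtain ⟨e, k, hk, hn⟩ := Nat.exists_eq_pow_mul_and_not_dvd n.succ_ne_zero p hp.ne_one
      exact ⟨(e, ⟨k, hk⟩), by simp [← hn]⟩

theorem powMulNotDvdEquiv_apply_add_one {p : ℕ} (hp : p.Prime) (x : ℕ × {k : ℕ // ¬ p ∣ k}) :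
    powMulNotDvdEquiv hp x + 1 = p ^ x.1 * (x.2 : ℕ) :=
  Nat.sub_add_cancel <| Nat.mul_pos (pow_pos hp.pos _)
    (Nat.pos_of_ne_zero fun h => x.2.2 (by rw [h]; exact dvd_zero p))

section Splitting

variable {p : ℕ} (hp : p.Prime) {a : ℕ → ℂ} {s : ℂ}
  (hmult : ∀ ℓ k : ℕ, ¬ p ∣ k → a (p ^ ℓ * k) = a (p ^ ℓ) * a k)
include hmult

theorem term_pow_mul (ℓ : ℕ) {k : ℕ} (hk : ¬ p ∣ k) :
    a (p ^ ℓ * k) * ((p ^ ℓ * k : ℕ) : ℂ) ^ (-s) =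
      a (p ^ ℓ) * ((p ^ ℓ : ℕ) : ℂ) ^ (-s) * (a k * (k : ℂ) ^ (-s)) := by
  rw [hmult ℓ k hk, Nat.cast_mul, Complex.natCast_mul_natCast_cpow]
  ring

include hp
variable (hsum : Summable fun n : ℕ => a (n + 1) * ((n + 1 : ℕ) : ℂ) ^ (-s))
include hsum

theorem summable_prod_split {ψ : ℕ → ℂ} (hψ : ∀ n, ‖ψ n‖ ≤ 1) :
    Summable fun x : ℕ × {k : ℕ // ¬ p ∣ k} =>
      a (p ^ x.1) * ((p ^ x.1 : ℕ) : ℂ) ^ (-s) *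
        (a x.2 * ((x.2 : ℕ) : ℂ) ^ (-s) * ψ (p ^ x.1 * x.2)) := by
  have h : Summable fun n : ℕ => a (n + 1) * ((n + 1 : ℕ) : ℂ) ^ (-s) * ψ (n + 1) := by
    refine Summable.of_norm_bounded hsum.norm fun n => ?_
    rw [norm_mul]
    exact mul_le_of_le_one_right (norm_nonneg _) (hψ _)
  refine ((powMulNotDvdEquiv hp).summable_iff.2 h).congr fun x => ?_
  simp only [Function.comp_apply, powMulNotDvdEquiv_apply_add_one]
  rw [term_pow_mul hmult x.1 x.2.2, mul_assoc]

theorem tsum_split {ψ : ℕ → ℂ} (hψ : ∀ n, ‖ψ n‖ ≤ 1) :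
    ∑' n : ℕ, a (n + 1) * ((n + 1 : ℕ) : ℂ) ^ (-s) * ψ (n + 1) =
      ∑' ℓ : ℕ, a (p ^ ℓ) * ((p ^ ℓ : ℕ) : ℂ) ^ (-s) *
        ∑' k : {k : ℕ // ¬ p ∣ k}, a k * ((k : ℕ) : ℂ) ^ (-s) * ψ (p ^ ℓ * k) := by
  rw [← (powMulNotDvdEquiv hp).tsum_eq]
  simp_rw [powMulNotDvdEquiv_apply_add_one, ← tsum_mul_left]
  rw [← (summable_prod_split hp hmult hsum hψ).tsum_prod]
  refine tsum_congr fun x => ?_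
  rw [term_pow_mul hmult x.1 x.2.2, mul_assoc]

theorem summable_localFactor (ha1 : a 1 = 1) :
    Summable fun ℓ : ℕ => a (p ^ ℓ) * ((p ^ ℓ : ℕ) : ℂ) ^ (-s) := by
  have h := (summable_prod_split hp hmult hsum (ψ := fun _ => 1) (by simp)).comp_injective
    (i := fun ℓ : ℕ => (ℓ, (⟨1, hp.not_dvd_one⟩ : {k : ℕ // ¬ p ∣ k})))
    fun _ _ h => congrArg Prod.fst h
  simpa [Function.comp_def, ha1] using h

theorem summable_coprime (ha1 : a 1 = 1) :
    Summable fun k : {k : ℕ // ¬ p ∣ k} => a k * ((k : ℕ) : ℂ) ^ (-s) := by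
  have h := (summable_prod_split hp hmult hsum (ψ := fun _ => 1) (by simp)).comp_injective
    (i := fun k : {k : ℕ // ¬ p ∣ k} => (0, k)) fun _ _ h => congrArg Prod.snd h
  simpa [Function.comp_def, ha1] using h

theorem dirSeries_eq_localFactor_mul :
    dirSeries a s =
      localFactor a p s * ∑' k : {k : ℕ // ¬ p ∣ k}, a k * ((k : ℕ) : ℂ) ^ (-s) := by
  have h := tsum_split hp hmult hsum (ψ := fun _ => 1) (by simp)
  simp only [mul_one] at h
  rw [dirSeries, h, tsum_mul_right, localFactor]

theorem charTwist_eq_tsum_coprime (ha1 : a 1 = 1) {N : ℕ} (hN : p ∣ N)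
    (χ : DirichletCharacter ℂ N) :
    charTwist a χ s =
      ∑' k : {k : ℕ // ¬ p ∣ k}, a k * ((k : ℕ) : ℂ) ^ (-s) * χ ((k : ℕ) : ZMod N) := by
  have h := tsum_split hp hmult hsum (ψ := fun n => χ (n : ZMod N)) fun n => χ.norm_le_one _
  have h0 : ∀ ℓ : ℕ, ℓ ≠ 0 → a (p ^ ℓ) * ((p ^ ℓ : ℕ) : ℂ) ^ (-s) *
      ∑' k : {k : ℕ // ¬ p ∣ k},
        a k * ((k : ℕ) : ℂ) ^ (-s) * χ ((p ^ ℓ * k : ℕ) : ZMod N) = 0 := by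
    intro ℓ hℓ
    have hz (k : ℕ) : χ ((p ^ ℓ * k : ℕ) : ZMod N) = 0 :=
      χ.natCast_eq_zero_of_dvd hp hN ((dvd_pow_self p hℓ).mul_right k)
    simp only [hz, mul_zero, tsum_zero]
  rw [tsum_eq_single 0 h0] at h
  simp only [pow_zero, ha1, Nat.cast_one, Complex.one_cpow, one_mul] at h
  rw [← h, charTwist]
  exact tsum_congr fun n => mul_right_comm _ _ _

theorem charTwist_primitiveCharacter_eq (ha1 : a 1 = 1) {r : ℕ}
    {χ : DirichletCharacter ℂ (p ^ r)} (hχ : χ ≠ 1) :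
    charTwist a χ.primitiveCharacter s =
      ∑' k : {k : ℕ // ¬ p ∣ k}, a k * ((k : ℕ) : ℂ) ^ (-s) * χ ((k : ℕ) : ZMod (p ^ r)) := by
  rw [charTwist_eq_tsum_coprime hp hmult hsum ha1 (dvd_conductor_of_ne_one hp hχ)]
  exact tsum_congr fun k => by rw [primitiveCharacter_natCast hp k.2]

theorem tsum_coprime_mul_exp (ha1 : a 1 = 1) {r : ℕ}
    [DecidablePred fun χ : DirichletCharacter ℂ (p ^ (r + 1)) => χ ≠ 1] (c : DirichletCharacter ℂ (p ^ (r + 1)) → ℂ)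
    (hc : ∀ n : ℕ, Nat.Coprime n p →
      Complex.exp (-(2 * Real.pi * Complex.I * n) / ((p ^ (r + 1) : ℕ) : ℂ)) =
        ∑ χ : DirichletCharacter ℂ (p ^ (r + 1)), c χ * χ (n : ZMod (p ^ (r + 1)))) :
    ∑' k : {k : ℕ // ¬ p ∣ k}, a k * ((k : ℕ) : ℂ) ^ (-s) *
        Complex.exp (-(2 * Real.pi * Complex.I * (k : ℕ)) / ((p ^ (r + 1) : ℕ) : ℂ)) =
      ∑ χ ∈ Finset.univ.filter (fun χ : DirichletCharacter ℂ (p ^ (r + 1)) => χ ≠ 1),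
          c χ * charTwist a χ.primitiveCharacter s +
        (if r = 0 then -1 / ((p : ℂ) - 1) else 0) *
          ∑' k : {k : ℕ // ¬ p ∣ k}, a k * ((k : ℕ) : ℂ) ^ (-s) := by
  have hcop (k : {k : ℕ // ¬ p ∣ k}) : Nat.Coprime k p :=
    ((Nat.Prime.coprime_iff_not_dvd hp).2 k.2).symm
  have hsumχ (χ : DirichletCharacter ℂ (p ^ (r + 1))) : Summable fun k : {k : ℕ // ¬ p ∣ k} =>
      a k * ((k : ℕ) : ℂ) ^ (-s) * χ ((k : ℕ) : ZMod (p ^ (r + 1))) := by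
    refine Summable.of_norm_bounded (summable_coprime hp hmult hsum ha1).norm fun k => ?_
    rw [norm_mul]
    exact mul_le_of_le_one_right (norm_nonneg _) (χ.norm_le_one _)
  have hexp : ∑' k : {k : ℕ // ¬ p ∣ k}, a k * ((k : ℕ) : ℂ) ^ (-s) *
        Complex.exp (-(2 * Real.pi * Complex.I * (k : ℕ)) / ((p ^ (r + 1) : ℕ) : ℂ)) =
      ∑ χ : DirichletCharacter ℂ (p ^ (r + 1)), c χ * ∑' k : {k : ℕ // ¬ p ∣ k},
        a k * ((k : ℕ) : ℂ) ^ (-s) * χ ((k : ℕ) : ZMod (p ^ (r + 1))) := by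
    simp_rw [← tsum_mul_left]
    rw [← Summable.tsum_finsetSum fun χ _ => (hsumχ χ).mul_left (c χ)]
    refine tsum_congr fun k => ?_
    rw [hc k (hcop k), Finset.mul_sum]
    exact Finset.sum_congr rfl fun χ _ => mul_left_comm _ _ _
  have hone : ∑' k : {k : ℕ // ¬ p ∣ k}, a k * ((k : ℕ) : ℂ) ^ (-s) *
        (1 : DirichletCharacter ℂ (p ^ (r + 1))) ((k : ℕ) : ZMod (p ^ (r + 1))) =
      ∑' k : {k : ℕ // ¬ p ∣ k}, a k * ((k : ℕ) : ℂ) ^ (-s) := by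
    refine tsum_congr fun k => ?_
    rw [MulChar.one_apply ((ZMod.isUnit_iff_coprime _ _).2 ((hcop k).pow_right _)), mul_one]
  classical
  rw [hexp, ← Finset.sum_erase_add _ _ (Finset.mem_univ 1), hone,
    trivial_fourier_coefficient hp c hc]
  congr 1
  refine Finset.sum_congr (by ext; simp) fun χ hχ => ?_
  rw [charTwist_primitiveCharacter_eq hp hmult hsum ha1 (Finset.mem_filter.1 hχ).2]

theorem linearTwist_eq_tsum (m : ℕ) :
    (Summable fun ℓ : ℕ => a (p ^ ℓ) * ((p ^ ℓ : ℕ) : ℂ) ^ (-s) *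
        ∑' k : {k : ℕ // ¬ p ∣ k}, a k * ((k : ℕ) : ℂ) ^ (-s) *
          Complex.exp (-(2 * Real.pi * Complex.I * (p ^ ℓ * k : ℕ)) / ((p ^ m : ℕ) : ℂ))) ∧
    linearTwist a (1 / (p ^ m : ℝ)) s =
      ∑' ℓ : ℕ, a (p ^ ℓ) * ((p ^ ℓ : ℕ) : ℂ) ^ (-s) *
        ∑' k : {k : ℕ // ¬ p ∣ k}, a k * ((k : ℕ) : ℂ) ^ (-s) *
          Complex.exp (-(2 * Real.pi * Complex.I * (p ^ ℓ * k : ℕ)) / ((p ^ m : ℕ) : ℂ)) := by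
  have hψ (n : ℕ) :
      ‖Complex.exp (-(2 * Real.pi * Complex.I * n) / ((p ^ m : ℕ) : ℂ))‖ ≤ 1 := by
    have h : -(2 * Real.pi * Complex.I * n) / ((p ^ m : ℕ) : ℂ) =
        ((-(2 * Real.pi * n) / (p ^ m : ℕ) : ℝ) : ℂ) * Complex.I := by
      push_cast
      ring
    rw [h, Complex.norm_exp_ofReal_mul_I]
  constructor
  · simp_rw [← tsum_mul_left]
    exact (summable_prod_split hp hmult hsum hψ).prod
  · rw [← tsum_split hp hmult hsum hψ, linearTwist]
    refine tsum_congr fun n => ?_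
    rw [mul_right_comm]
    congr 2
    push_cast
    ring

end Splitting

/-- Lemma 2 of the paper. For a function splitting at the prime `p`,
the linear twist `F(s, 1/p^m)` decomposes via twists by primitive Dirichlet characters
of `p`-power modulus. -/
theorem linear_twist_decomposition (p m : ℕ) [Fact p.Prime] (hm : 1 ≤ m)
    (a : ℕ → ℂ) (ha1 : a 1 = 1)
    (habs : ∀ σ : ℝ, 1 < σ → Summable fun n : ℕ => ‖a (n + 1)‖ / ((n + 1 : ℕ) : ℝ) ^ σ)
    (hmult : ∀ ℓ k : ℕ, ¬ p ∣ k → a (p ^ ℓ * k) = a (p ^ ℓ) * a k)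
    (hFp : ∀ s : ℂ, 1 < s.re → localFactor a p s ≠ 0)
    (c : (r : ℕ) → DirichletCharacter ℂ (p ^ r) → ℂ)
    (hc : ∀ r : ℕ, 1 ≤ r → ∀ n : ℕ, Nat.Coprime n p →
      Complex.exp (-(2 * Real.pi * Complex.I * n) / ((p ^ r : ℕ) : ℂ)) =
        ∑ χ : DirichletCharacter ℂ (p ^ r), c r χ * χ (n : ZMod (p ^ r))) :
    ∀ s : ℂ, 1 < s.re →
      linearTwist a (1 / (p ^ m : ℝ)) s =
        (∑ ℓ ∈ Finset.range m, a (p ^ ℓ) * ((p ^ ℓ : ℕ) : ℂ) ^ (-s) *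
          ∑ χ ∈ Finset.univ.filter
              (fun χ : DirichletCharacter ℂ (p ^ (m - ℓ)) => χ ≠ 1),
            c (m - ℓ) χ * charTwist a χ.primitiveCharacter s) +
        (1 - Wpoly a p m ((p : ℂ) ^ (-s)) * (localFactor a p s)⁻¹) * dirSeries a s := by
  intro s hs
  have hp : p.Prime := Fact.out
  have hp0 : (p : ℂ) ≠ 0 := by exact_mod_cast hp.ne_zero
  have hp1 : (p : ℂ) - 1 ≠ 0 := sub_ne_zero.2 (by exact_mod_cast hp.one_lt.ne')
  have hsum : Summable fun n : ℕ => a (n + 1) * ((n + 1 : ℕ) : ℂ) ^ (-s) := by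
    refine Summable.of_norm_bounded (habs s.re hs) fun n => le_of_eq ?_
    rw [norm_mul, Complex.norm_natCast_cpow_of_pos n.succ_pos, Complex.neg_re,
      Real.rpow_neg (Nat.cast_nonneg _), div_eq_mul_inv]
  obtain ⟨hsumT, hT⟩ := linearTwist_eq_tsum hp hmult hsum m
  have hloc := (summable_localFactor hp hmult hsum ha1).sum_add_tsum_nat_add m
  have hF := dirSeries_eq_localFactor_mul hp hmult hsum
  have hW : Wpoly a p m ((p : ℂ) ^ (-s)) =
      ∑ ℓ ∈ Finset.range m, a (p ^ ℓ) * ((p ^ ℓ : ℕ) : ℂ) ^ (-s) +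
        1 / ((p : ℂ) - 1) * (a (p ^ (m - 1)) * ((p ^ (m - 1) : ℕ) : ℂ) ^ (-s)) := by
    have hpow (ℓ : ℕ) : ((p : ℂ) ^ (-s)) ^ ℓ = ((p ^ ℓ : ℕ) : ℂ) ^ (-s) := by
      rw [Nat.cast_pow, ← Complex.natCast_cpow_natCast_mul, Complex.cpow_nat_mul]
    obtain ⟨q, rfl⟩ := Nat.exists_eq_add_of_le' hm
    simp only [Wpoly, hpow, Nat.add_sub_cancel, Finset.sum_range_succ]
    field_simp
    ring
  set G : ℂ := ∑' k : {k : ℕ // ¬ p ∣ k}, a k * ((k : ℕ) : ℂ) ^ (-s) with hG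
  have hlow (ℓ : ℕ) (hℓ : ℓ ∈ Finset.range m) :
      a (p ^ ℓ) * ((p ^ ℓ : ℕ) : ℂ) ^ (-s) *
        ∑' k : {k : ℕ // ¬ p ∣ k}, a k * ((k : ℕ) : ℂ) ^ (-s) *
          Complex.exp (-(2 * Real.pi * Complex.I * (p ^ ℓ * k : ℕ)) / ((p ^ m : ℕ) : ℂ)) =
      a (p ^ ℓ) * ((p ^ ℓ : ℕ) : ℂ) ^ (-s) *
          (∑ χ ∈ Finset.univ.filter (fun χ : DirichletCharacter ℂ (p ^ (m - ℓ)) => χ ≠ 1),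
            c (m - ℓ) χ * charTwist a χ.primitiveCharacter s) +
        if ℓ = m - 1 then
          -(1 / ((p : ℂ) - 1) * (a (p ^ (m - 1)) * ((p ^ (m - 1) : ℕ) : ℂ) ^ (-s))) * G else 0 := by
    obtain ⟨r, rfl⟩ := Nat.exists_eq_add_of_lt (Finset.mem_range.1 hℓ)
    have hr : ℓ + r + 1 - ℓ = r + 1 := by omega
    have hexp (k : ℕ) :
        -(2 * Real.pi * Complex.I * (p ^ ℓ * k : ℕ)) / ((p ^ (ℓ + r + 1) : ℕ) : ℂ) =
          -(2 * Real.pi * Complex.I * k) / ((p ^ (r + 1) : ℕ) : ℂ) := by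
      push_cast
      field_simp
      ring
    simp_rw [hexp]
    rw [hr, tsum_coprime_mul_exp hp hmult hsum ha1 (c (r + 1)) (hc (r + 1) (Nat.le_add_left 1 r)),
      ← hG, mul_add]
    congr 1
    by_cases h0 : r = 0
    · subst h0
      simp only [if_true, Nat.add_sub_cancel, add_zero]
      ring
    · rw [if_neg h0, if_neg (by omega), zero_mul, mul_zero]
  have hhigh (ℓ : ℕ) :
      a (p ^ (ℓ + m)) * ((p ^ (ℓ + m) : ℕ) : ℂ) ^ (-s) *
        ∑' k : {k : ℕ // ¬ p ∣ k}, a k * ((k : ℕ) : ℂ) ^ (-s) *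
          Complex.exp (-(2 * Real.pi * Complex.I * (p ^ (ℓ + m) * k : ℕ)) / ((p ^ m : ℕ) : ℂ)) =
      a (p ^ (ℓ + m)) * ((p ^ (ℓ + m) : ℕ) : ℂ) ^ (-s) * G := by
    rw [hG]
    congr 1
    refine tsum_congr fun k => ?_
    have hexp : -(2 * Real.pi * Complex.I * (p ^ (ℓ + m) * k : ℕ)) / ((p ^ m : ℕ) : ℂ) =
        ((-(p ^ ℓ * k : ℕ) : ℤ) : ℂ) * (2 * Real.pi * Complex.I) := by
      push_cast
      field_simp
      ring
    rw [hexp, Complex.exp_int_mul_two_pi_mul_I, mul_one]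
  rw [hT, ← hsumT.sum_add_tsum_nat_add m, Finset.sum_congr rfl hlow, Finset.sum_add_distrib,
    tsum_congr hhigh, tsum_mul_right, Finset.sum_ite_eq',
    if_pos (Finset.mem_range.2 (Nat.sub_lt hm one_pos)), add_assoc]
  congr 1
  have hloc' : ∑' ℓ : ℕ, a (p ^ (ℓ + m)) * ((p ^ (ℓ + m) : ℕ) : ℂ) ^ (-s) =
      localFactor a p s - ∑ ℓ ∈ Finset.range m, a (p ^ ℓ) * ((p ^ ℓ : ℕ) : ℂ) ^ (-s) :=
    eq_sub_of_add_eq' hloc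
  rw [hloc', hF, hW]
  have hne := hFp s hs
  field_simp
  ring
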